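/- Let φ : ℝⁿ → ℝ be smooth, X : ℝⁿ → ℝⁿ a smooth vector field with dφₚ(X(p)) > 0 for all p with X(p) ≠ 0, and suppose the zero set of X equals the critical set of φ. Suppose there are open sets U₀ ⊆ U₁ with Crit(φ) ⊆ U₀, closure of U₀ contained in U₁, and a smooth map G₁ : U₁ → Mat_n(ℝ) with ⟨G₁(p)v, v⟩ > 0 for v ≠ 0 and G₁(p)·X(p) = ∇φ(p) on U₁. Then there exists a smooth map G : ℝⁿ → Mat_n(ℝ) with ⟨G(p)v,v⟩ > 0 for all v ≠ 0 and G(p)·X(p) = ∇φ(p) for all p ∈ ℝⁿ. -/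

import Mathlib

open RealInnerProductSpace in
theorem gradlike_near_crit_implies_gradlike_global {n : ℕ}
    (φ : EuclideanSpace ℝ (Fin n) → ℝ)
    (X : EuclideanSpace ℝ (Fin n) → EuclideanSpace ℝ (Fin n))
    (hφ : ContDiff ℝ (⊤ : ℕ∞) φ) (hX : ContDiff ℝ (⊤ : ℕ∞) X)
    (hweak : ∀ p, X p ≠ 0 → 0 < fderiv ℝ φ p (X p))
    (hzero : {p | X p = 0} = {p | fderiv ℝ φ p = 0})
    (U₀ U₁ : Set (EuclideanSpace ℝ (Fin n))) (hU₀ : IsOpen U₀) (hU₁ : IsOpen U₁)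
    (hcrit : {p | fderiv ℝ φ p = 0} ⊆ U₀) (hcl : closure U₀ ⊆ U₁)
    (G₁ : EuclideanSpace ℝ (Fin n) →
      (EuclideanSpace ℝ (Fin n) →L[ℝ] EuclideanSpace ℝ (Fin n)))
    (hG₁smooth : ContDiffOn ℝ (⊤ : ℕ∞) G₁ U₁)
    (hG₁pos : ∀ p ∈ U₁, ∀ v, v ≠ 0 → 0 < ⟪G₁ p v, v⟫)
    (hG₁eq : ∀ p ∈ U₁, G₁ p (X p) = gradient φ p) :
    ∃ G : EuclideanSpace ℝ (Fin n) →
        (EuclideanSpace ℝ (Fin n) →L[ℝ] EuclideanSpace ℝ (Fin n)),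
      ContDiff ℝ (⊤ : ℕ∞) G ∧ (∀ p, ∀ v, v ≠ 0 → 0 < ⟪G p v, v⟫) ∧
      ∀ p, G p (X p) = gradient φ p := by
  let t : EuclideanSpace ℝ (Fin n) →
      Set (EuclideanSpace ℝ (Fin n) →L[ℝ] EuclideanSpace ℝ (Fin n)) :=
    fun p => {A | (∀ v, v ≠ 0 → 0 < ⟪A v, v⟫) ∧ A (X p) = gradient φ p}
  have ht : ∀ p, Convex ℝ (t p) := by
    rintro p A ⟨hA, hA'⟩ B ⟨hB, hB'⟩ a b ha hb hab
    refine ⟨fun v hv => ?_, ?_⟩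
    · have h1 := hA v hv
      have h2 := hB v hv
      simp only [_root_.add_apply, _root_.smul_apply, inner_add_left,
        real_inner_smul_left]
      rcases ha.eq_or_lt with rfl | ha
      · have : b = 1 := by linarith
        subst this; linarith
      · have := mul_pos ha h1
        have := mul_nonneg hb h2.le
        linarith
    · simp only [_root_.add_apply, _root_.smul_apply, hA', hB']
      rw [← add_smul, hab, one_smul]
  have hdφ : ContDiff ℝ (⊤ : ℕ∞) (fderiv ℝ φ) := hφ.fderiv_right (by simp)
  have hg : ContDiff ℝ (⊤ : ℕ∞) (gradient φ) :=
    (InnerProductSpace.toDual ℝ (EuclideanSpace ℝ (Fin n))).symm.contDiff.comp hdφ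
  have hin : ∀ p v, ⟪gradient φ p, v⟫ = fderiv ℝ φ p v := fun p v => by
    simp [gradient]
  have ha : ContDiff ℝ (⊤ : ℕ∞) (fun p => fderiv ℝ φ p (X p)) := hdφ.clm_apply hX
  have key : ∀ p, ∃ U ∈ nhds p, ∃ g : EuclideanSpace ℝ (Fin n) →
        (EuclideanSpace ℝ (Fin n) →L[ℝ] EuclideanSpace ℝ (Fin n)),
      ContDiffOn ℝ (⊤ : ℕ∞) g U ∧ ∀ y ∈ U, g y ∈ t y := by
    intro p
    by_cases hp : X p = 0
    · have hpU : p ∈ U₁ := hcl (subset_closure (hcrit (hzero ▸ hp)))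
      exact ⟨U₁, hU₁.mem_nhds hpU, G₁, hG₁smooth, fun y hy => ⟨hG₁pos y hy, hG₁eq y hy⟩⟩
    · have ho : IsOpen {q | 0 < fderiv ℝ φ q (X q)} := isOpen_lt continuous_const ha.continuous
      refine ⟨_, ho.mem_nhds (hweak p hp), fun q =>
        (fderiv ℝ φ q (X q))⁻¹ • (fderiv ℝ φ q).smulRight (gradient φ q) +
        (ContinuousLinearMap.id ℝ _ - (fderiv ℝ φ q (X q))⁻¹ •
            (innerSL ℝ (X q)).smulRight (gradient φ q)).comp
        (ContinuousLinearMap.id ℝ _ - (fderiv ℝ φ q (X q))⁻¹ •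
            (fderiv ℝ φ q).smulRight (X q)), ?_, ?_⟩
      · have hai : ContDiffOn ℝ (⊤ : ℕ∞) (fun q => (fderiv ℝ φ q (X q))⁻¹)
            {q | 0 < fderiv ℝ φ q (X q)} := ha.contDiffOn.inv (fun q hq => ne_of_gt hq)
        have hi : ContDiff ℝ (⊤ : ℕ∞) (fun q => innerSL ℝ (X q)) :=
          (innerSL ℝ).contDiff.comp hX
        exact (hai.smul (hdφ.smulRight hg).contDiffOn).add
          ((contDiffOn_const.sub (hai.smul (hi.smulRight hg).contDiffOn)).clm_comp
           (contDiffOn_const.sub (hai.smul (hdφ.smulRight hX).contDiffOn)))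
      · intro q hq
        have hq0 : 0 < fderiv ℝ φ q (X q) := hq
        refine ⟨fun v hv => ?_, ?_⟩
        · set a := fderiv ℝ φ q (X q) with hadef
          set w := v - (a⁻¹ * fderiv ℝ φ q v) • X q with hw
          have e : ⟪(a⁻¹ • (fderiv ℝ φ q).smulRight (gradient φ q) +
            (ContinuousLinearMap.id ℝ _ - a⁻¹ •
            (innerSL ℝ (X q)).smulRight (gradient φ q)).comp
            (ContinuousLinearMap.id ℝ _ - a⁻¹ •
            (fderiv ℝ φ q).smulRight (X q))) v, v⟫ =
              a⁻¹ * (fderiv ℝ φ q v)^2 + ⟪w, w⟫ := by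
            have : (ContinuousLinearMap.id ℝ (EuclideanSpace ℝ (Fin n)) - a⁻¹ •
              (fderiv ℝ φ q).smulRight (X q)) v = w := by
              simp [hw, smul_smul]
            rw [_root_.add_apply, ContinuousLinearMap.comp_apply, this]
            have h2 : ⟪w, w⟫ = ⟪w, v⟫ - (a⁻¹ * fderiv ℝ φ q v) * ⟪w, X q⟫ := by
              conv_lhs => rw [hw, ← hw]
              nth_rw 2 [hw]
              rw [inner_sub_right, real_inner_smul_right]
            rw [h2]
            simp only [_root_.smul_apply, ContinuousLinearMap.smulRight_apply,
              _root_.sub_apply, ContinuousLinearMap.id_apply, innerSL_apply_apply,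
              inner_add_left, inner_sub_left, real_inner_smul_left, hin,
              real_inner_comm w (X q)]
            ring
          refine lt_of_lt_of_eq ?_ e.symm
          by_cases h0 : fderiv ℝ φ q v = 0
          · have : w = v := by simp [hw, h0]
            rw [this, h0]
            have := real_inner_self_pos.2 hv
            simpa using this
          · have := real_inner_self_nonneg (x := w)
            positivity
        · have := hq0.ne'
          simp [smul_smul, smul_sub, this]
          rw [sub_eq_zero]
          congr 1
          field_simp
  obtain ⟨G, hG⟩ := exists_contMDiffMap_forall_mem_convex_of_local
    (modelWithCornersSelf ℝ (EuclideanSpace ℝ (Fin n))) (n := (⊤ : ℕ∞)) ht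
    (fun p => by
      obtain ⟨U, hU, g, h1, h2⟩ := key p
      exact ⟨U, hU, g, h1.contMDiffOn, h2⟩)
  exact ⟨G, G.contMDiff.contDiff, fun p => (hG p).1, fun p => (hG p).2⟩
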